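/- Let σ : (ℝ²,0) → (ℝ²,0) be a bi-Lipschitz homeomorphism germ, and let f, g : (ℝ²,0) → (ℝ,0) be real analytic germs, mini-regular in x, with f = g ∘ σ on a neighbourhood of the origin. Let γ : x = λ(y) and γ̃ : x = λ̃(y) be allowable real analytic demi-branches with σ(γ) = γ̃ as set germs at the origin (i.e. there is a neighbourhood U of the origin with σ(γ ∩ U) = γ̃ ∩ σ(U)). Then for every ξ ≥ 1 the following holds: if f admits along γ the expansion (e, P) at rate ξ and g admits along γ̃ the expansion (ẽ, Q) at rate ξ, with P and Q nonzero polynomials, then e = ẽ and deg P = deg Q. In particular the order functions ξ ↦ e(ξ) of f relative to γ and of g relative to γ̃ coincide on [1, ∞). -/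

import Mathlib

open Filter Topology Polynomial

noncomputable section

/-- A bi-Lipschitz homeomorphism germ at the origin of the plane. -/
def IsBiLipschitzGerm (σ : ℝ × ℝ → ℝ × ℝ) : Prop :=
  σ 0 = 0 ∧ ∃ (U V : Set (ℝ × ℝ)) (τ : ℝ × ℝ → ℝ × ℝ) (K : NNReal),
    IsOpen U ∧ IsOpen V ∧ (0 : ℝ × ℝ) ∈ U ∧ (0 : ℝ × ℝ) ∈ V ∧
    Set.MapsTo σ U V ∧ Set.MapsTo τ V U ∧
    (∀ x ∈ U, τ (σ x) = x) ∧ (∀ y ∈ V, σ (τ y) = y) ∧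
    LipschitzOnWith K σ U ∧ LipschitzOnWith K τ V

/-- An allowable real analytic demi-branch `x = λ(y)`, `y ≥ 0`. -/
def AllowableBranch (lam : ℝ → ℝ) : Prop :=
  ∃ (N : ℕ) (μ : ℝ → ℝ), 0 < N ∧ AnalyticAt ℝ μ 0 ∧ μ 0 = 0 ∧
    (∀ᶠ y in 𝓝[≥] (0 : ℝ), lam y = μ (y ^ ((N : ℝ)⁻¹))) ∧
    ∃ C > (0 : ℝ), ∀ᶠ y in 𝓝[≥] (0 : ℝ), |lam y| ≤ C * y

/-- The demi-branch `x = λ(y)`, `y ≥ 0`, considered as a subset of the plane. -/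
def branchSet (lam : ℝ → ℝ) : Set (ℝ × ℝ) :=
  {p : ℝ × ℝ | 0 ≤ p.2 ∧ p.1 = lam p.2}

/-- `f` admits along the demi-branch `x = λ(y)` the expansion `(e, P)` at rate `ξ`. -/
def AdmitsExpansion (f : ℝ × ℝ → ℝ) (lam : ℝ → ℝ) (ξ e : ℝ) (P : Polynomial ℝ) : Prop :=
  ∀ R > (0 : ℝ), ∀ ε > (0 : ℝ), ∀ᶠ y in 𝓝[>] (0 : ℝ), ∀ z : ℝ, |z| ≤ R →
    |f (lam y + z * y ^ ξ, y) - P.eval z * y ^ e| ≤ ε * y ^ e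

/-- `f` is mini-regular in `x`: its initial homogeneous form does not vanish at `(1,0)`. -/
def MiniRegularInX (f : ℝ × ℝ → ℝ) : Prop :=
  ∃ m : ℕ, (∀ j < m, iteratedFDeriv ℝ j f 0 = 0) ∧
    iteratedFDeriv ℝ m f 0 (fun _ => ((1 : ℝ), (0 : ℝ))) ≠ 0

lemma Polynomial.exists_abs_eval_le (Q : ℝ[X]) :
    ∃ C > 0, ∀ z : ℝ, |Q.eval z| ≤ C * (1 + |z|) ^ Q.natDegree := by
  refine ⟨∑ i ∈ Finset.range (Q.natDegree + 1), |Q.coeff i| + 1, by positivity, fun z => ?_⟩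
  rw [Polynomial.eval_eq_sum_range]
  have hz : 0 ≤ |z| := abs_nonneg z
  calc |∑ i ∈ Finset.range (Q.natDegree + 1), Q.coeff i * z ^ i|
      ≤ ∑ i ∈ Finset.range (Q.natDegree + 1), |Q.coeff i * z ^ i| := Finset.abs_sum_le_sum_abs _ _
    _ ≤ ∑ i ∈ Finset.range (Q.natDegree + 1), |Q.coeff i| * (1 + |z|) ^ Q.natDegree := by
        refine Finset.sum_le_sum fun i hi => ?_
        rw [abs_mul, abs_pow]
        gcongr
        calc |z| ^ i ≤ (1 + |z|) ^ i := by gcongr; linarith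
          _ ≤ (1 + |z|) ^ Q.natDegree :=
            pow_le_pow_right₀ (by linarith) (by simpa [Nat.lt_succ_iff] using hi)
    _ ≤ _ := by
        rw [← Finset.sum_mul]
        gcongr
        linarith

lemma Polynomial.natDegree_le_of_abs_eval_le {P : ℝ[X]} (hP : P ≠ 0) {d : ℕ} {B : ℝ}
    (h : ∀ᶠ z : ℝ in atTop, |P.eval z| ≤ B * (1 + z) ^ d) : P.natDegree ≤ d := by
  by_contra! hd
  have hB : 0 < |B| + 1 := by positivity
  have hdeg : (((1 : ℝ[X]) + X) ^ d).degree < P.degree := by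
    rw [Polynomial.degree_eq_natDegree hP]
    refine lt_of_le_of_lt Polynomial.degree_le_natDegree ?_
    have : ((1 : ℝ[X]) + X).natDegree = 1 := by
      rw [add_comm]; exact Polynomial.natDegree_X_add_C (1 : ℝ)
    rw [Polynomial.natDegree_pow, this, mul_one]
    exact_mod_cast hd
  have hlim := (Polynomial.div_tendsto_atTop_zero_iff_degree_lt _ _ hP).2 hdeg
  have hev := hlim.eventually (Metric.ball_mem_nhds 0 (ε := 1 / (|B| + 1)) (by positivity))
  obtain ⟨z, h1, h2, h3, h4⟩ :=
    (h.and ((Polynomial.eventually_atTop_not_isRoot P hP).and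
      (hev.and (eventually_ge_atTop (0 : ℝ))))).exists
  have hPz : 0 < |P.eval z| := abs_pos.2 h2
  have hz : 0 < (1 + z) ^ d := by positivity
  simp only [eval_pow, eval_add, eval_one, eval_X, dist_zero_right,
    Real.norm_eq_abs, abs_div, abs_of_pos hz] at h3
  rw [div_lt_div_iff₀ hPz hB] at h3
  nlinarith [le_abs_self B]

lemma exponent_le_of_eventually_le {a D e e' : ℝ} (ha : 0 < a)
    (h : ∀ᶠ y in 𝓝[>] (0 : ℝ), a * y ^ e ≤ D * y ^ e') : e' ≤ e := by
  by_contra! hlt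
  have hlim : Tendsto (fun y : ℝ => D * y ^ (e' - e)) (𝓝[>] 0) (𝓝 0) := by
    have := ((Real.continuousAt_rpow_const 0 (e' - e) (Or.inr (by linarith))).tendsto.mono_left
      nhdsWithin_le_nhds : Tendsto _ (𝓝[>] (0 : ℝ)) _)
    rw [Real.zero_rpow (by linarith)] at this
    simpa using this.const_mul D
  obtain ⟨y, h1, h2, h3⟩ := (h.and ((hlim.eventually_lt_const ha).and
    (self_mem_nhdsWithin : Set.Ioi (0 : ℝ) ∈ 𝓝[>] (0 : ℝ)))).exists
  have hy : 0 < y := h3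
  have : y ^ e' = y ^ (e' - e) * y ^ e := by rw [← Real.rpow_add hy]; congr 1; ring
  rw [this, ← mul_assoc] at h1
  have := Real.rpow_pos_of_pos hy e
  nlinarith

lemma coeff_le_of_eventually_le {a D e : ℝ}
    (h : ∀ᶠ y in 𝓝[>] (0 : ℝ), a * y ^ e ≤ D * y ^ e) : a ≤ D := by
  obtain ⟨y, h1, h2⟩ := (h.and (self_mem_nhdsWithin : Set.Ioi (0 : ℝ) ∈ 𝓝[>] (0 : ℝ))).exists
  exact le_of_mul_le_mul_right h1 (Real.rpow_pos_of_pos h2 e)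

lemma AdmitsExpansion.of_upper_bound {f : ℝ × ℝ → ℝ} {lam : ℝ → ℝ} {ξ e e' B : ℝ} {P : ℝ[X]}
    {d : ℕ} (hP : P ≠ 0) (hexp : AdmitsExpansion f lam ξ e P)
    (hB : ∀ z > 0, ∀ᶠ y in 𝓝[>] (0 : ℝ), |f (lam y + z * y ^ ξ, y)| ≤ B * (1 + z) ^ d * y ^ e') :
    e' ≤ e ∧ (e = e' → P.natDegree ≤ d) := by
  have key : ∀ z > 0, ∀ ε > 0, ∀ᶠ y in 𝓝[>] (0 : ℝ),
      (|P.eval z| - ε) * y ^ e ≤ B * (1 + z) ^ d * y ^ e' := by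
    intro z hz ε hε
    filter_upwards [hexp z hz ε hε, hB z hz, self_mem_nhdsWithin] with y h1 h2 h3
    have hy := Real.rpow_pos_of_pos h3 e
    have h4 := h1 z (abs_of_pos hz).le
    have h5 : |P.eval z * y ^ e| = |P.eval z| * y ^ e := by rw [abs_mul, abs_of_pos hy]
    have h6 := abs_sub_abs_le_abs_sub (P.eval z * y ^ e) (f (lam y + z * y ^ ξ, y))
    rw [abs_sub_comm, h5] at h6
    linarith
  constructor
  · obtain ⟨z, h1, h2⟩ :=
      ((Polynomial.eventually_atTop_not_isRoot P hP).and (eventually_gt_atTop (0 : ℝ))).exists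
    have hPz : 0 < |P.eval z| := abs_pos.2 h1
    exact exponent_le_of_eventually_le (by linarith) (key z h2 (|P.eval z| / 2) (by positivity))
  · rintro rfl
    refine Polynomial.natDegree_le_of_abs_eval_le (B := B + 1) hP ?_
    filter_upwards [eventually_gt_atTop (0 : ℝ)] with z hz
    have h1 := coeff_le_of_eventually_le (key z hz 1 one_pos)
    have h2 : 1 ≤ (1 + z) ^ d := one_le_pow₀ (by linarith)
    linarith

lemma AdmitsExpansion.of_lower_bound {f : ℝ × ℝ → ℝ} {lam : ℝ → ℝ} {ξ e e' c z₀ : ℝ} {P : ℝ[X]}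
    {d : ℕ} (hc : 0 < c) (hexp : AdmitsExpansion f lam ξ e P)
    (hB : ∀ z > z₀, ∀ᶠ y in 𝓝[>] (0 : ℝ), c * z ^ d * y ^ e' ≤ |f (lam y + z * y ^ ξ, y)|) :
    e ≤ e' ∧ (e = e' → d ≤ P.natDegree) := by
  have key : ∀ z > 0, z > z₀ → ∀ᶠ y in 𝓝[>] (0 : ℝ),
      c * z ^ d * y ^ e' ≤ (|P.eval z| + 1) * y ^ e := by
    intro z hz hz0
    filter_upwards [hexp z hz 1 one_pos, hB z hz0, self_mem_nhdsWithin] with y h1 h2 h3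
    have hy := Real.rpow_pos_of_pos h3 e
    have h4 := h1 z (abs_of_pos hz).le
    have h5 : |P.eval z * y ^ e| = |P.eval z| * y ^ e := by rw [abs_mul, abs_of_pos hy]
    have h6 := abs_sub_abs_le_abs_sub (f (lam y + z * y ^ ξ, y)) (P.eval z * y ^ e)
    rw [h5] at h6
    linarith
  constructor
  · have hz : 0 < |z₀| + 1 := by positivity
    exact exponent_le_of_eventually_le (by positivity)
      (key (|z₀| + 1) hz (by linarith [le_abs_self z₀]))
  · rintro rfl
    obtain ⟨C, hC, hCP⟩ := P.exists_abs_eval_le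
    have hne : (Polynomial.C c * X ^ d : ℝ[X]) ≠ 0 := by simp [hc.ne']
    have := Polynomial.natDegree_le_of_abs_eval_le (d := P.natDegree) (B := C + 1) hne ?_
    · rwa [Polynomial.natDegree_C_mul_X_pow _ _ hc.ne'] at this
    filter_upwards [eventually_gt_atTop (0 : ℝ), eventually_gt_atTop z₀] with z hz hz0
    have h1 := coeff_le_of_eventually_le (key z hz hz0)
    have h2 : 1 ≤ (1 + z) ^ P.natDegree := one_le_pow₀ (by linarith)
    have h3 := hCP z
    rw [abs_of_pos hz] at h3
    rw [eval_mul, eval_C, eval_pow, eval_X, abs_of_pos (by positivity)]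
    linarith

lemma exists_eq_pow_mul_of_abs_le {μ : ℝ → ℝ} (hμ : AnalyticAt ℝ μ 0) {N : ℕ} {C : ℝ}
    (h : ∀ᶠ t in 𝓝[>] (0 : ℝ), |μ t| ≤ C * t ^ N) :
    ∃ ν : ℝ → ℝ, AnalyticAt ℝ ν 0 ∧ ∀ᶠ t in 𝓝 (0 : ℝ), μ t = t ^ N * ν t := by
  suffices hN : (N : ℕ∞) ≤ analyticOrderAt μ 0 by
    simpa using (natCast_le_analyticOrderAt hμ).1 hN
  by_contra! hlt
  obtain ⟨n, hn⟩ := ENat.ne_top_iff_exists.1 hlt.ne_top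
  rw [← hn] at hlt
  have hnN : n < N := by exact_mod_cast hlt
  obtain ⟨ν, hν, hν0, hev⟩ := (hμ.analyticOrderAt_eq_natCast).1 hn.symm
  simp only [sub_zero, smul_eq_mul] at hev
  have hle : ∀ᶠ t in 𝓝[>] (0 : ℝ), |ν t| ≤ C * t ^ (N - n) := by
    filter_upwards [h, hev.filter_mono nhdsWithin_le_nhds, self_mem_nhdsWithin] with t h1 h2 h3
    have ht : 0 < t := h3
    have : t ^ N = t ^ n * t ^ (N - n) := by rw [← pow_add]; congr 1; omega
    rw [h2, abs_mul, abs_of_pos (pow_pos ht n), this] at h1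
    have := pow_pos ht n
    refine le_of_mul_le_mul_left ?_ this
    linarith
  have hl1 : Tendsto (fun t => |ν t|) (𝓝[>] (0 : ℝ)) (𝓝 |ν 0|) :=
    (hν.continuousAt.abs.tendsto).mono_left nhdsWithin_le_nhds
  have hl2 : Tendsto (fun t : ℝ => C * t ^ (N - n)) (𝓝[>] (0 : ℝ)) (𝓝 0) := by
    have hc : Continuous fun t : ℝ => C * t ^ (N - n) := by fun_prop
    have := (hc.tendsto 0).mono_left (nhdsWithin_le_nhds (s := Set.Ioi 0))
    rwa [zero_pow (by omega), mul_zero] at this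
  exact absurd (le_of_tendsto_of_tendsto hl1 hl2 hle) (not_le.2 (abs_pos.2 hν0))

lemma AllowableBranch.exists_lipschitz {lam : ℝ → ℝ} (h : AllowableBranch lam) :
    lam 0 = 0 ∧ ∃ L > 0, ∃ δ > 0, ∀ s ∈ Set.Icc 0 δ, ∀ t ∈ Set.Icc 0 δ,
      |lam s - lam t| ≤ L * |s - t| := by
  obtain ⟨N, μ, hN, hμ, hμ0, hlam, C, hC, hbd⟩ := h
  have hN0 : (N : ℝ)⁻¹ ≠ 0 := by positivity
  refine ⟨by simpa [hN0, hμ0] using hlam.self_of_nhdsWithin (Set.mem_Ici.2 le_rfl), ?_⟩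
  have hpow : Tendsto (fun t : ℝ => t ^ N) (𝓝[>] 0) (𝓝[≥] 0) := by
    refine tendsto_nhdsWithin_iff.2 ⟨?_, ?_⟩
    · have := ((continuous_pow N).tendsto (0 : ℝ)).mono_left (nhdsWithin_le_nhds (s := Set.Ioi 0))
      rwa [zero_pow hN.ne'] at this
    · filter_upwards [self_mem_nhdsWithin] with t ht
      exact (pow_pos (Set.mem_Ioi.1 ht) N).le
  obtain ⟨ν, hν, hμν⟩ := exists_eq_pow_mul_of_abs_le (N := N) (C := C) hμ (by
    filter_upwards [hpow.eventually hlam, hpow.eventually hbd, self_mem_nhdsWithin] with t h1 h2 h3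
    have ht : 0 < t := h3
    rwa [h1, Real.pow_rpow_inv_natCast ht.le hN.ne'] at h2)
  obtain ⟨K, S, hS, hK⟩ := (hν.contDiffAt (n := 1)).exists_lipschitzOnWith
  have hbν : ∀ᶠ t in 𝓝 (0 : ℝ), |ν t| < |ν 0| + 1 :=
    hν.continuousAt.abs.eventually_lt_const (lt_add_one _)
  have hroot : Tendsto (fun y : ℝ => y ^ (N : ℝ)⁻¹) (𝓝[≥] 0) (𝓝 0) := by
    have := (Real.continuousAt_rpow_const 0 (N : ℝ)⁻¹ (Or.inr (by positivity))).tendsto.mono_left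
      (nhdsWithin_le_nhds (s := Set.Ici 0))
    rwa [Real.zero_rpow hN0] at this
  have hall := (hlam.and (hroot.eventually (hμν.and (hbν.and (Filter.inter_mem hS (Iio_mem_nhds one_pos))))))
  obtain ⟨δ, hδ, hsub⟩ := mem_nhdsGE_iff_exists_Icc_subset.1 hall
  refine ⟨|ν 0| + 1 + K, by positivity, δ, hδ, ?_⟩
  have main : ∀ s ∈ Set.Icc 0 δ, ∀ t ∈ Set.Icc 0 δ, s ≤ t →
      |lam s - lam t| ≤ (|ν 0| + 1 + K) * |s - t| := by
    intro s hs t ht hst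
    obtain ⟨hs1, hs2, hs3, hs4, hs5⟩ := hsub hs
    obtain ⟨ht1, ht2, ht3, ht4, ht5⟩ := hsub ht
    rw [hs1, ht1, hs2, ht2, Real.rpow_inv_natCast_pow hs.1 hN.ne',
      Real.rpow_inv_natCast_pow ht.1 hN.ne']
    set u := s ^ (N : ℝ)⁻¹
    set v := t ^ (N : ℝ)⁻¹
    have hu0 : 0 ≤ u := Real.rpow_nonneg hs.1 _
    have huv : u ≤ v := Real.rpow_le_rpow hs.1 hst (by positivity)
    have hlip : |ν u - ν v| ≤ K * (v - u) := by
      have := hK.norm_sub_le hs4 ht4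
      rwa [Real.norm_eq_abs, Real.norm_eq_abs, abs_sub_comm u v,
        abs_of_nonneg (sub_nonneg.2 huv)] at this
    have hsu : s = u ^ N := (Real.rpow_inv_natCast_pow hs.1 hN.ne').symm
    have htv : t = v ^ N := (Real.rpow_inv_natCast_pow ht.1 hN.ne').symm
    have hv1 : 0 ≤ v := hu0.trans huv
    have hgap : s * (v - u) ≤ v * (t - s) := by
      rw [hsu, htv]
      obtain ⟨M, rfl⟩ : ∃ M, N = M + 1 := ⟨N - 1, by omega⟩
      have h1 : u ^ M * v ≤ v ^ (M + 1) := by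
        rw [pow_succ]
        gcongr
      calc u ^ (M + 1) * (v - u) = u * (u ^ M * v - u ^ (M + 1)) := by ring
        _ ≤ u * (v ^ (M + 1) - u ^ (M + 1)) := by gcongr
        _ ≤ v * (v ^ (M + 1) - u ^ (M + 1)) := by
          gcongr
          linarith [pow_le_pow_left₀ hu0 huv (M + 1)]
    have hKn : (0 : ℝ) ≤ K := K.2
    calc |s * ν u - t * ν v| = |s * (ν u - ν v) + (s - t) * ν v| := by congr 1; ring
      _ ≤ |s * (ν u - ν v)| + |(s - t) * ν v| := abs_add_le _ _
      _ = s * |ν u - ν v| + |s - t| * |ν v| := by rw [abs_mul, abs_mul, abs_of_nonneg hs.1]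
      _ ≤ s * (K * (v - u)) + |s - t| * (|ν 0| + 1) := by
          gcongr
          exact hs.1
      _ = K * (s * (v - u)) + |s - t| * (|ν 0| + 1) := by ring
      _ ≤ K * (1 * |s - t|) + |s - t| * (|ν 0| + 1) := by
          have : s * (v - u) ≤ 1 * |s - t| := by
            rw [abs_sub_comm, abs_of_nonneg (sub_nonneg.2 hst)]
            refine hgap.trans ?_
            gcongr
            exact le_of_lt ht5
          gcongr
      _ = _ := by ring
  intro s hs t ht
  rcases le_total s t with h | h
  · exact main s hs t ht h
  · rw [abs_sub_comm, abs_sub_comm s t]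
    exact main t ht s hs h

lemma MiniRegularInX.exists_bounds {f : ℝ × ℝ → ℝ} (h : MiniRegularInX f)
    (hf : AnalyticAt ℝ f 0) : ∃ m : ℕ,
      (∃ C > 0, ∀ᶠ v in 𝓝 (0 : ℝ × ℝ), |f v| ≤ C * ‖v‖ ^ m) ∧
      ∃ c > 0, ∃ η > 0, ∀ᶠ v in 𝓝 (0 : ℝ × ℝ), |v.2| ≤ η * |v.1| → c * |v.1| ^ m ≤ |f v| := by
  obtain ⟨m, hlow, hm⟩ := h
  obtain ⟨p, r, hp⟩ := hf
  have hp0 : ∀ j < m, ∀ v : ℝ × ℝ, (p j fun _ => v) = 0 := by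
    intro j hj v
    have := hp.factorial_smul v j
    rw [hlow j hj] at this
    simpa [Nat.factorial_ne_zero] using this
  have hpm : (p m fun _ => ((1 : ℝ), (0 : ℝ))) ≠ 0 := by
    rw [← hp.factorial_smul] at hm
    exact right_ne_zero_of_smul hm
  have hpart : ∀ v, p.partialSum (m + 1) v = p m fun _ => v := by
    intro v
    rw [FormalMultilinearSeries.partialSum, Finset.sum_range_succ,
      Finset.sum_eq_zero fun j hj => hp0 j (Finset.mem_range.1 hj) v, zero_add]
  refine ⟨m, ?_, ?_⟩
  · have hO := hp.hasFPowerSeriesAt.isBigO_sub_partialSum_pow m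
    obtain ⟨C, hC, hb⟩ := hO.exists_pos
    refine ⟨C, hC, ?_⟩
    filter_upwards [hb.bound] with v hv
    have h0 : p.partialSum m v = 0 :=
      Finset.sum_eq_zero fun j hj => hp0 j (Finset.mem_range.1 hj) v
    simpa [h0] using hv
  · have hO := hp.hasFPowerSeriesAt.isBigO_sub_partialSum_pow (m + 1)
    obtain ⟨C, hC, hb⟩ := hO.exists_pos
    set a := |p m fun _ => ((1 : ℝ), (0 : ℝ))|
    have ha0 : 0 < a := abs_pos.2 hpm
    have hcont : Continuous fun u : ℝ => |p m fun _ => ((1 : ℝ), u)| :=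
      ((p m).cont.comp (by fun_prop)).abs
    have hev : ∀ᶠ u in 𝓝 (0 : ℝ), a / 2 < |p m fun _ => ((1 : ℝ), u)| :=
      hcont.continuousAt.eventually_const_lt (by linarith)
    obtain ⟨η, hη, hηb⟩ := Metric.eventually_nhds_iff.1 hev
    refine ⟨a / 4, by positivity, min (η / 2) 1, by positivity, ?_⟩
    filter_upwards [hb.bound, Metric.ball_mem_nhds (0 : ℝ × ℝ) (ε := a / (4 * C)) (by positivity)]
      with v hv hvb hslope
    rw [zero_add, hpart, Real.norm_eq_abs, norm_pow, norm_norm] at hv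
    have hle : |v.2| ≤ |v.1| :=
      hslope.trans (mul_le_of_le_one_left (abs_nonneg _) (min_le_right _ _))
    have hnorm : ‖v‖ = |v.1| := by
      rw [Prod.norm_def, Real.norm_eq_abs, Real.norm_eq_abs, max_eq_left hle]
    rw [mem_ball_zero_iff, hnorm, lt_div_iff₀ (by positivity)] at hvb
    have hform : a / 2 * |v.1| ^ m ≤ |p m fun _ => v| := by
      rcases eq_or_ne v.1 0 with h0 | h0
      · have hv0 : v = 0 := by
          rw [h0, abs_zero] at hle
          exact Prod.ext h0 (abs_nonpos_iff.1 hle)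
        subst hv0
        rcases Nat.eq_zero_or_pos m with rfl | hm0
        · have : (fun _ : Fin 0 => (0 : ℝ × ℝ)) = fun _ => ((1 : ℝ), (0 : ℝ)) :=
            Subsingleton.elim _ _
          rw [this, pow_zero]
          linarith
        · simp [zero_pow hm0.ne']
      · have hv1 : v = v.1 • ((1 : ℝ), v.2 / v.1) :=
          Prod.ext (by simp) (by simp; field_simp)
        have hsc : (p m fun _ => v) = v.1 ^ m * p m fun _ => ((1 : ℝ), v.2 / v.1) := by
          conv_lhs => rw [hv1]
          rw [(p m).map_smul_univ (fun _ => v.1)]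
          simp
        rw [hsc, abs_mul, abs_pow, mul_comm]
        gcongr
        refine (hηb ?_).le
        rw [dist_zero_right, Real.norm_eq_abs, abs_div, div_lt_iff₀ (abs_pos.2 h0)]
        have : min (η / 2) 1 ≤ η / 2 := min_le_left _ _
        have h0' := abs_pos.2 h0
        nlinarith
    have h6 := abs_sub_abs_le_abs_sub (p m fun _ => v) (f v)
    rw [abs_sub_comm] at h6
    rw [hnorm, pow_succ] at hv
    have h7 : 0 ≤ |v.1| ^ m := by positivity
    nlinarith

lemma tendsto_horn {lam : ℝ → ℝ} {C₀ ξ : ℝ} (hξ : 0 < ξ)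
    (hlam : ∀ᶠ y in 𝓝[>] (0 : ℝ), |lam y| ≤ C₀ * y) (z : ℝ) :
    Tendsto (fun y => (lam y + z * y ^ ξ, y)) (𝓝[>] (0 : ℝ)) (𝓝 (0 : ℝ × ℝ)) := by
  have hid : Tendsto (fun y : ℝ => y) (𝓝[>] 0) (𝓝 0) := tendsto_id.mono_left nhdsWithin_le_nhds
  have h1 : Tendsto lam (𝓝[>] 0) (𝓝 0) :=
    squeeze_zero_norm' hlam (by simpa using hid.const_mul C₀)
  have h2 : Tendsto (fun y : ℝ => z * y ^ ξ) (𝓝[>] 0) (𝓝 0) := by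
    have := hid.rpow_const (p := ξ) (Or.inr hξ.le)
    rw [Real.zero_rpow hξ.ne'] at this
    simpa using this.const_mul z
  have := (h1.add h2).prodMk_nhds hid
  rwa [add_zero] at this

lemma exists_upper_bound_rate_one {f : ℝ × ℝ → ℝ} {lam : ℝ → ℝ} {C₀ C : ℝ} {m : ℕ} (hC : 0 < C)
    (hlam : ∀ᶠ y in 𝓝[>] (0 : ℝ), |lam y| ≤ C₀ * y)
    (hf : ∀ᶠ v in 𝓝 (0 : ℝ × ℝ), |f v| ≤ C * ‖v‖ ^ m) :
    ∃ B, ∀ z > 0, ∀ᶠ y in 𝓝[>] (0 : ℝ),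
      |f (lam y + z * y ^ (1 : ℝ), y)| ≤ B * (1 + z) ^ m * y ^ (m : ℝ) := by
  refine ⟨C * (|C₀| + 1) ^ m, fun z hz => ?_⟩
  filter_upwards [(tendsto_horn one_pos hlam z).eventually hf, hlam, self_mem_nhdsWithin]
    with y h1 h2 h3
  have hy : 0 < y := h3
  refine h1.trans ?_
  rw [Real.rpow_natCast, mul_assoc, mul_assoc, ← mul_pow, ← mul_pow]
  gcongr
  have hC0 := le_abs_self C₀
  have hC1 := abs_nonneg C₀
  rw [Real.rpow_one, Prod.norm_def, Real.norm_eq_abs, Real.norm_eq_abs, abs_of_pos hy]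
  refine max_le ((abs_add_le _ _).trans ?_) ?_
  · rw [abs_of_pos (mul_pos hz hy)]
    nlinarith [mul_pos hz hy, mul_nonneg hC1 (mul_pos hz hy).le, mul_le_mul_of_nonneg_right hC0 hy.le]
  · nlinarith [mul_pos hz hy, mul_nonneg hC1 (mul_pos hz hy).le, mul_nonneg hC1 hy.le]

lemma exists_lower_bound_rate_one {f : ℝ × ℝ → ℝ} {lam : ℝ → ℝ} {C₀ c η : ℝ} {m : ℕ} (hc : 0 < c)
    (hη : 0 < η) (hlam : ∀ᶠ y in 𝓝[>] (0 : ℝ), |lam y| ≤ C₀ * y)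
    (hf : ∀ᶠ v in 𝓝 (0 : ℝ × ℝ), |v.2| ≤ η * |v.1| → c * |v.1| ^ m ≤ |f v|) :
    ∃ c' > 0, ∃ z₀, ∀ z > z₀, ∀ᶠ y in 𝓝[>] (0 : ℝ),
      c' * z ^ m * y ^ (m : ℝ) ≤ |f (lam y + z * y ^ (1 : ℝ), y)| := by
  refine ⟨c * (1 / 2) ^ m, by positivity, 2 * |C₀| + 2 / η, fun z hz => ?_⟩
  filter_upwards [(tendsto_horn one_pos hlam z).eventually hf, hlam, self_mem_nhdsWithin]
    with y h1 h2 h3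
  have hy : 0 < y := h3
  have hC0 := le_abs_self C₀
  have hz0 : 0 < z := lt_of_le_of_lt (by positivity) hz
  have hlow : 1 / 2 * z * y ≤ |lam y + z * y ^ (1 : ℝ)| := by
    rw [Real.rpow_one]
    have h4 := neg_abs_le (lam y)
    have h5 := le_abs_self (lam y + z * y)
    have h6 : 0 < 2 / η := by positivity
    have h7 : |C₀| * y ≤ z / 2 * y := by gcongr; linarith
    nlinarith
  have hslope : |y| ≤ η * |lam y + z * y ^ (1 : ℝ)| := by
    rw [abs_of_pos hy]
    have h6 : 2 / η ≤ z := by linarith [abs_nonneg C₀]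
    rw [div_le_iff₀ hη] at h6
    calc y = 1 / 2 * 2 * y := by ring
      _ ≤ 1 / 2 * (z * η) * y := by gcongr
      _ = η * (1 / 2 * z * y) := by ring
      _ ≤ _ := by gcongr
  refine le_trans ?_ (h1 hslope)
  rw [Real.rpow_natCast, mul_assoc, mul_assoc, ← mul_pow, ← mul_pow, ← mul_assoc]
  gcongr

lemma AdmitsExpansion.rate_one {f : ℝ × ℝ → ℝ} {lam : ℝ → ℝ} {C₀ C c η e : ℝ} {m : ℕ} {P : ℝ[X]}
    (hexp : AdmitsExpansion f lam 1 e P) (hP : P ≠ 0)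
    (hlam : ∀ᶠ y in 𝓝[>] (0 : ℝ), |lam y| ≤ C₀ * y)
    (hC : 0 < C) (hfu : ∀ᶠ v in 𝓝 (0 : ℝ × ℝ), |f v| ≤ C * ‖v‖ ^ m) (hc : 0 < c) (hη : 0 < η)
    (hfl : ∀ᶠ v in 𝓝 (0 : ℝ × ℝ), |v.2| ≤ η * |v.1| → c * |v.1| ^ m ≤ |f v|) :
    e = m ∧ P.natDegree = m := by
  obtain ⟨B, hB⟩ := exists_upper_bound_rate_one hC hlam hfu
  obtain ⟨c', hc', z₀, hz₀⟩ := exists_lower_bound_rate_one hc hη hlam hfl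
  obtain ⟨h1, h2⟩ := hexp.of_upper_bound hP hB
  obtain ⟨h3, h4⟩ := hexp.of_lower_bound hc' hz₀
  have he : e = m := le_antisymm h3 h1
  exact ⟨he, le_antisymm (h2 he) (h4 he)⟩

lemma rpow_le_add_mul_rpow {a b y t e : ℝ} (ha : 0 < a) (hb : 0 < b) (hy : 0 < y)
    (hta : a * y ≤ t) (htb : t ≤ b * y) : t ^ e ≤ (a ^ e + b ^ e) * y ^ e := by
  have hae : 0 < a ^ e := Real.rpow_pos_of_pos ha e
  have hbe : 0 < b ^ e := Real.rpow_pos_of_pos hb e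
  have hye : 0 < y ^ e := Real.rpow_pos_of_pos hy e
  have hay : 0 < a * y := mul_pos ha hy
  rcases le_total 0 e with he | he
  · calc t ^ e ≤ (b * y) ^ e := Real.rpow_le_rpow (hay.le.trans hta) htb he
      _ = b ^ e * y ^ e := Real.mul_rpow hb.le hy.le
      _ ≤ _ := by gcongr; linarith
  · calc t ^ e ≤ (a * y) ^ e := Real.rpow_le_rpow_of_nonpos hay hta he
      _ = a ^ e * y ^ e := Real.mul_rpow ha.le hy.le
      _ ≤ _ := by gcongr; linarith

/-- Domination of the values of `f` on the horn of rate `ξ` around `x = λ(y)` by those of `g` on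
the corresponding horn around `x = λ'(y)`. -/
lemma exists_upper_bound_of_lipschitz {σ : ℝ × ℝ → ℝ × ℝ} {f g : ℝ × ℝ → ℝ} {lam lam' : ℝ → ℝ}
    {K C₀ L δ ξ e' : ℝ} {U : Set (ℝ × ℝ)} {Q : ℝ[X]} (hξ : 1 < ξ) (hK : 0 < K)
    (hU : U ∈ 𝓝 (0 : ℝ × ℝ)) (hσ : ∀ v ∈ U, ∀ w ∈ U, ‖σ v - σ w‖ ≤ K * ‖v - w‖) (hσ0 : σ 0 = 0)
    (hσinv : ∀ v ∈ U, ‖v‖ ≤ K * ‖σ v‖) (hfg : ∀ᶠ v in 𝓝 (0 : ℝ × ℝ), f v = g (σ v))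
    (hC₀ : 0 < C₀) (hlam : ∀ᶠ y in 𝓝[>] (0 : ℝ), |lam y| ≤ C₀ * y)
    (hL : 0 < L) (hδ : 0 < δ) (hlam0 : lam' 0 = 0)
    (hlam' : ∀ s ∈ Set.Icc 0 δ, ∀ t ∈ Set.Icc 0 δ, |lam' s - lam' t| ≤ L * |s - t|)
    (hbr : ∀ᶠ y in 𝓝[>] (0 : ℝ), ∃ y' ≥ 0, σ (lam y, y) = (lam' y', y'))
    (hexp : AdmitsExpansion g lam' ξ e' Q) :
    ∃ B, ∀ z > 0, ∀ᶠ y in 𝓝[>] (0 : ℝ),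
      |f (lam y + z * y ^ ξ, y)| ≤ B * (1 + z) ^ Q.natDegree * y ^ e' := by
  obtain ⟨CQ, hCQ, hQ⟩ := Q.exists_abs_eval_le
  set a : ℝ := 1 / (K * (L + 1)) / 2 with ha
  set b : ℝ := K * (C₀ + 1) + a with hb
  have ha0 : 0 < a := by positivity
  have hb0 : 0 < b := by positivity
  set κ : ℝ := K * (1 + L) / a ^ ξ with hκ
  have hκ0 : 0 < κ := by positivity
  refine ⟨(CQ * (1 + κ) ^ Q.natDegree + 1) * (a ^ e' + b ^ e'), fun z hz => ?_⟩
  have hid : Tendsto (fun y : ℝ => y) (𝓝[>] 0) (𝓝 0) := tendsto_id.mono_left nhdsWithin_le_nhds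
  have hsmall : ∀ᶠ y in 𝓝[>] (0 : ℝ), K * z * y ^ (ξ - 1) < a := by
    have := hid.rpow_const (p := ξ - 1) (Or.inr (by linarith))
    rw [Real.zero_rpow (by linarith)] at this
    have := this.const_mul (K * z)
    rw [mul_zero] at this
    exact this.eventually_lt_const ha0
  have hg := hexp (κ * z) (by positivity) 1 one_pos
  obtain ⟨ρ, hρ, hgρ⟩ := mem_nhdsGT_iff_exists_Ioo_subset.1 hg
  have hbρ : ∀ᶠ y in 𝓝[>] (0 : ℝ), b * y < min δ ρ := by
    have := hid.const_mul b
    rw [mul_zero] at this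
    exact this.eventually_lt_const (lt_min hδ hρ)
  have hhorn := tendsto_horn (ξ := ξ) (by linarith) hlam z
  have hcen : Tendsto (fun y => (lam y, y)) (𝓝[>] (0 : ℝ)) (𝓝 (0 : ℝ × ℝ)) := by
    simpa using tendsto_horn one_pos hlam 0
  filter_upwards [hsmall, hbρ, hhorn.eventually hU, hcen.eventually hU, hhorn.eventually hfg, hlam,
    hbr, self_mem_nhdsWithin] with y h1 h2 h3 h4 h5 h6 h7 h8
  obtain ⟨y', hy'0, hy'⟩ := h7
  have hy : 0 < y := h8
  have hyδ : b * y < δ := h2.trans_le (min_le_left _ _)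
  have hyρ : b * y < ρ := h2.trans_le (min_le_right _ _)
  have hpn : ‖((lam y, y) : ℝ × ℝ)‖ ≤ (C₀ + 1) * y := by
    rw [Prod.norm_def, Real.norm_eq_abs, Real.norm_eq_abs, abs_of_pos hy]
    exact max_le (by linarith) (by nlinarith)
  have hy'b : y' ≤ K * (C₀ + 1) * y := by
    have h := hσ _ h4 0 (mem_of_mem_nhds hU)
    rw [hσ0, sub_zero, sub_zero, hy'] at h
    have h' : |y'| ≤ ‖((lam' y', y') : ℝ × ℝ)‖ := norm_snd_le (lam' y', y')
    have h'' := mul_le_mul_of_nonneg_left hpn hK.le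
    linarith [le_abs_self y']
  have hy'δ : y' ∈ Set.Icc 0 δ := ⟨hy'0, by nlinarith [mul_pos ha0 hy]⟩
  have hy'a : 2 * a * y ≤ y' := by
    have h := hσinv _ h4
    rw [hy'] at h
    have h' : |y| ≤ ‖((lam y, y) : ℝ × ℝ)‖ := norm_snd_le (lam y, y)
    rw [abs_of_pos hy] at h'
    have hl := hlam' y' hy'δ 0 ⟨le_rfl, hδ.le⟩
    rw [hlam0, sub_zero, sub_zero, abs_of_nonneg hy'0] at hl
    have hn : ‖((lam' y', y') : ℝ × ℝ)‖ ≤ (L + 1) * y' := by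
      rw [Prod.norm_def, Real.norm_eq_abs, Real.norm_eq_abs, abs_of_nonneg hy'0]
      exact max_le (by linarith) (by nlinarith)
    have h9 : y ≤ K * (L + 1) * y' := by
      have := mul_le_mul_of_nonneg_left hn hK.le
      linarith
    calc 2 * a * y = 1 / (K * (L + 1)) * y := by rw [ha]; ring
      _ ≤ 1 / (K * (L + 1)) * (K * (L + 1) * y') := by gcongr
      _ = y' := by field_simp
  obtain ⟨⟨x, t⟩, hq⟩ : ∃ q, σ (lam y + z * y ^ ξ, y) = q := ⟨_, rfl⟩
  have hyξ : 0 < y ^ ξ := Real.rpow_pos_of_pos hy ξ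
  have hdist : ‖((x, t) : ℝ × ℝ) - (lam' y', y')‖ ≤ K * z * y ^ ξ := by
    have h := hσ _ h3 _ h4
    rw [hq, hy', Prod.mk_sub_mk, Prod.mk_sub_mk, sub_self, add_sub_cancel_left] at h
    have : ‖((z * y ^ ξ, (0 : ℝ)) : ℝ × ℝ)‖ = z * y ^ ξ := by
      rw [Prod.norm_def, norm_zero, Real.norm_eq_abs, abs_of_pos (by positivity),
        max_eq_left (by positivity)]
    rw [this] at h
    rw [Prod.mk_sub_mk]
    linarith
  have hx : |x - lam' y'| ≤ K * z * y ^ ξ := (norm_fst_le _).trans hdist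
  have ht : |t - y'| ≤ K * z * y ^ ξ := (norm_snd_le _).trans hdist
  have hpow : K * z * y ^ ξ ≤ a * y := by
    have : y ^ ξ = y ^ (ξ - 1) * y := by
      rw [← Real.rpow_add_one hy.ne']; congr 1; ring
    rw [this, ← mul_assoc]
    gcongr
  have hta : a * y ≤ t := by linarith [neg_abs_le (t - y')]
  have htb : t ≤ b * y := by
    rw [hb, add_mul]
    linarith [le_abs_self (t - y')]
  have ht0 : 0 < t := lt_of_lt_of_le (by positivity) hta
  have htξ : 0 < t ^ ξ := Real.rpow_pos_of_pos ht0 ξ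
  have hxt : |x - lam' t| ≤ K * (1 + L) * z * y ^ ξ := by
    have h := hlam' y' hy'δ t ⟨ht0.le, by linarith⟩
    rw [abs_sub_comm y' t] at h
    have h' := abs_add_le (x - lam' y') (lam' y' - lam' t)
    rw [sub_add_sub_cancel] at h'
    have := mul_le_mul_of_nonneg_left ht hL.le
    linarith
  obtain ⟨w, hw⟩ : ∃ w, w = (x - lam' t) / t ^ ξ := ⟨_, rfl⟩
  have hxw : x = lam' t + w * t ^ ξ := by rw [hw]; field_simp; ring
  have hwb : |w| ≤ κ * z := by
    rw [hw, abs_div, abs_of_pos htξ, div_le_iff₀ htξ]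
    refine hxt.trans ?_
    calc K * (1 + L) * z * y ^ ξ = κ * z * (a * y) ^ ξ := by
          rw [hκ, Real.mul_rpow ha0.le hy.le]
          field_simp
      _ ≤ κ * z * t ^ ξ := by gcongr
  have hgt := hgρ ⟨ht0, htb.trans_lt hyρ⟩ w hwb
  rw [← hxw] at hgt
  have hte : 0 < t ^ e' := Real.rpow_pos_of_pos ht0 e'
  have hgle : |g (x, t)| ≤ (|Q.eval w| + 1) * t ^ e' := by
    have h := abs_sub_abs_le_abs_sub (g (x, t)) (Q.eval w * t ^ e')
    rw [abs_mul, abs_of_pos hte] at h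
    linarith
  have hQw : |Q.eval w| + 1 ≤ (CQ * (1 + κ) ^ Q.natDegree + 1) * (1 + z) ^ Q.natDegree := by
    have h : 1 + |w| ≤ (1 + κ) * (1 + z) := by nlinarith
    have h' : 1 ≤ (1 + z) ^ Q.natDegree := one_le_pow₀ (by linarith)
    calc |Q.eval w| + 1 ≤ CQ * ((1 + κ) * (1 + z)) ^ Q.natDegree + (1 + z) ^ Q.natDegree := by
          refine add_le_add ((hQ w).trans ?_) h'
          gcongr
      _ = _ := by rw [mul_pow]; ring
  have hte' := rpow_le_add_mul_rpow (e := e') ha0 hb0 hy hta htb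
  rw [h5, hq]
  calc |g (x, t)| ≤ (|Q.eval w| + 1) * t ^ e' := hgle
    _ ≤ ((CQ * (1 + κ) ^ Q.natDegree + 1) * (1 + z) ^ Q.natDegree) *
        ((a ^ e' + b ^ e') * y ^ e') := by gcongr
    _ = _ := by ring

/-- If a bi-Lipschitz map sends a demi-branch into another one, then its inverse sends the second
demi-branch into the first. -/
lemma eventually_inverse_mem_branch {σ τ : ℝ × ℝ → ℝ × ℝ} {lam lam' : ℝ → ℝ} {L δ : ℝ}
    {U : Set (ℝ × ℝ)} (hU : U ∈ 𝓝 (0 : ℝ × ℝ)) (hσ : ContinuousOn σ U) (hσ0 : σ 0 = 0)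
    (hτσ : ∀ v ∈ U, τ (σ v) = v) (hδ : 0 < δ) (hlam0 : lam 0 = 0)
    (hlam : ∀ s ∈ Set.Icc 0 δ, ∀ t ∈ Set.Icc 0 δ, |lam s - lam t| ≤ L * |s - t|)
    (hlam'0 : lam' 0 = 0)
    (hcen : Tendsto (fun y => (lam y, y)) (𝓝[>] (0 : ℝ)) (𝓝 (0 : ℝ × ℝ)))
    (hbr : ∀ᶠ y in 𝓝[>] (0 : ℝ), ∃ y' ≥ 0, σ (lam y, y) = (lam' y', y')) :
    ∀ᶠ y' in 𝓝[>] (0 : ℝ), ∃ y ≥ 0, τ (lam' y', y') = (lam y, y) := by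
  have hδ' : ∀ᶠ y in 𝓝[>] (0 : ℝ), y ≤ δ :=
    nhdsWithin_le_nhds (Iic_mem_nhds hδ)
  obtain ⟨d, hd, hsub⟩ :=
    mem_nhdsGT_iff_exists_Ioc_subset.1 (((hcen.eventually hU).and hbr).and hδ')
  have hd0 : 0 < d := hd
  have hmem : ∀ y ∈ Set.Icc 0 d,
      (lam y, y) ∈ U ∧ (∃ y' ≥ 0, σ (lam y, y) = (lam' y', y')) ∧ y ≤ δ := by
    intro y hy
    rcases hy.1.eq_or_lt with rfl | h
    · rw [hlam0, Prod.mk_zero_zero, hσ0]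
      exact ⟨mem_of_mem_nhds hU, ⟨0, le_rfl, by rw [hlam'0, Prod.mk_zero_zero]⟩, hδ.le⟩
    · obtain ⟨⟨h1, h2⟩, h3⟩ := hsub ⟨h, hy.2⟩
      exact ⟨h1, h2, h3⟩
  have hlamc : ContinuousOn lam (Set.Icc 0 d) := by
    refine (LipschitzOnWith.of_dist_le_mul (K := L.toNNReal) fun s hs t ht => ?_).continuousOn
    rw [Real.dist_eq, Real.dist_eq]
    refine (hlam s ⟨hs.1, (hmem s hs).2.2⟩ t ⟨ht.1, (hmem t ht).2.2⟩).trans ?_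
    gcongr
    exact Real.le_coe_toNNReal L
  have hcont : ContinuousOn (fun y => (σ (lam y, y)).2) (Set.Icc 0 d) :=
    continuous_snd.comp_continuousOn
      (hσ.comp (hlamc.prodMk continuousOn_id) fun y hy => (hmem y hy).1)
  have hpos : 0 < (σ (lam d, d)).2 := by
    obtain ⟨h1, ⟨y', hy'0, hy'⟩, -⟩ := hmem d ⟨hd0.le, le_rfl⟩
    rw [hy']
    refine lt_of_le_of_ne hy'0 fun h => ?_
    subst h
    have h2 := hτσ _ h1
    rw [hy', hlam'0, Prod.mk_zero_zero, ← hσ0, hτσ 0 (mem_of_mem_nhds hU)] at h2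
    exact hd0.ne (congrArg Prod.snd h2)
  have hivt := intermediate_value_Icc hd0.le hcont
  filter_upwards [Ioo_mem_nhdsGT hpos] with y' hy'
  obtain ⟨y, hy, hyy'⟩ := hivt ⟨by rw [hlam0, Prod.mk_zero_zero, hσ0]; exact hy'.1.le, hy'.2.le⟩
  obtain ⟨h1, ⟨y'', -, h2⟩, -⟩ := hmem y hy
  have : y'' = y' := by simpa [h2] using hyy'
  subst this
  exact ⟨y, hy.1, by rw [← h2, hτσ _ h1]⟩

lemma eventually_abs_le_of_lipschitz {lam : ℝ → ℝ} {L δ : ℝ} (hδ : 0 < δ) (hlam0 : lam 0 = 0)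
    (hlam : ∀ s ∈ Set.Icc 0 δ, ∀ t ∈ Set.Icc 0 δ, |lam s - lam t| ≤ L * |s - t|) :
    ∀ᶠ y in 𝓝[>] (0 : ℝ), |lam y| ≤ L * y := by
  filter_upwards [Ioc_mem_nhdsGT hδ] with y hy
  simpa [hlam0, abs_of_pos hy.1] using hlam y ⟨hy.1.le, hy.2⟩ 0 ⟨le_rfl, hδ.le⟩

lemma eventually_comp_le_norm_pow {σ : ℝ × ℝ → ℝ × ℝ} {f g : ℝ × ℝ → ℝ} {K C : ℝ} {m : ℕ}
    {U : Set (ℝ × ℝ)} (hC : 0 < C) (hU : U ∈ 𝓝 (0 : ℝ × ℝ))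
    (hσ : ∀ v ∈ U, ∀ w ∈ U, ‖σ v - σ w‖ ≤ K * ‖v - w‖) (hσ0 : σ 0 = 0)
    (hfg : ∀ᶠ v in 𝓝 (0 : ℝ × ℝ), f v = g (σ v))
    (hg : ∀ᶠ v in 𝓝 (0 : ℝ × ℝ), |g v| ≤ C * ‖v‖ ^ m) :
    ∀ᶠ v in 𝓝 (0 : ℝ × ℝ), |f v| ≤ C * K ^ m * ‖v‖ ^ m := by
  have hle : ∀ v ∈ U, ‖σ v‖ ≤ K * ‖v‖ := fun v hv => by
    simpa [hσ0] using hσ v hv 0 (mem_of_mem_nhds hU)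
  have hlim : Tendsto σ (𝓝 0) (𝓝 0) := by
    refine squeeze_zero_norm' (Filter.mem_of_superset hU hle) ?_
    have : Continuous fun v : ℝ × ℝ => K * ‖v‖ := by fun_prop
    simpa using this.tendsto 0
  filter_upwards [hfg, hlim.eventually hg, hU] with v h1 h2 h3
  rw [h1, mul_assoc, ← mul_pow]
  refine h2.trans ?_
  gcongr
  exact hle v h3

/-- If `σ` is bi-Lipschitz, `f = g ∘ σ` and `σ(γ) = γ̃` as set germs, then the order functions
and the degrees of the coefficient polynomials of `f` along `γ` and of `g` along `γ̃`
coincide for all `ξ ≥ 1`. -/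
theorem stmt5 (σ : ℝ × ℝ → ℝ × ℝ) (hσ : IsBiLipschitzGerm σ)
    (f g : ℝ × ℝ → ℝ) (hfa : AnalyticAt ℝ f 0) (hga : AnalyticAt ℝ g 0)
    (hf0 : f 0 = 0) (hg0 : g 0 = 0)
    (hfm : MiniRegularInX f) (hgm : MiniRegularInX g)
    (hfg : ∀ᶠ p in 𝓝 (0 : ℝ × ℝ), f p = g (σ p))
    (lam lam' : ℝ → ℝ) (hγ : AllowableBranch lam) (hγ' : AllowableBranch lam')
    (himage : ∃ U : Set (ℝ × ℝ), IsOpen U ∧ (0 : ℝ × ℝ) ∈ U ∧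
      σ '' (branchSet lam ∩ U) = branchSet lam' ∩ (σ '' U)) :
    ∀ ξ : ℝ, 1 ≤ ξ → ∀ (e e' : ℝ) (P Q : Polynomial ℝ), P ≠ 0 → Q ≠ 0 →
      AdmitsExpansion f lam ξ e P → AdmitsExpansion g lam' ξ e' Q →
      e = e' ∧ P.degree = Q.degree := by
  intro ξ hξ e e' P Q hP hQ hPexp hQexp
  obtain ⟨hσ0, U, V, τ, K, hUo, hVo, h0U, h0V, -, -, hτσ, hστ, hσL, hτL⟩ := hσ
  have hτ0 : τ 0 = 0 := by simpa [hσ0] using hτσ 0 h0U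
  have hU : U ∈ 𝓝 (0 : ℝ × ℝ) := hUo.mem_nhds h0U
  have hV : V ∈ 𝓝 (0 : ℝ × ℝ) := hVo.mem_nhds h0V
  have hK : (0 : ℝ) < K + 1 := by positivity
  have hσK : ∀ v ∈ U, ∀ w ∈ U, ‖σ v - σ w‖ ≤ (K + 1) * ‖v - w‖ := fun v hv w hw =>
    (hσL.norm_sub_le hv hw).trans (by gcongr; linarith)
  have hτK : ∀ v ∈ V, ∀ w ∈ V, ‖τ v - τ w‖ ≤ (K + 1) * ‖v - w‖ := fun v hv w hw =>
    (hτL.norm_sub_le hv hw).trans (by gcongr; linarith)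
  have hσinv : ∀ᶠ v in 𝓝 (0 : ℝ × ℝ), ‖v‖ ≤ (K + 1) * ‖σ v‖ := by
    have hlim : Tendsto σ (𝓝 0) (𝓝 0) := by
      have := hσL.continuousOn.continuousAt hU
      rwa [ContinuousAt, hσ0] at this
    filter_upwards [hU, hlim hV] with v hv hv'
    simpa [hτσ v hv, hτ0] using hτK _ hv' 0 h0V
  have hτlim : Tendsto τ (𝓝 0) (𝓝 0) := by
    have := hτL.continuousOn.continuousAt hV
    rwa [ContinuousAt, hτ0] at this
  have hτinv : ∀ᶠ v in 𝓝 (0 : ℝ × ℝ), ‖v‖ ≤ (K + 1) * ‖τ v‖ := by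
    filter_upwards [hV, hτlim hU] with v hv hv'
    simpa [hστ v hv, hσ0] using hσK _ hv' 0 h0U
  have hgf : ∀ᶠ w in 𝓝 (0 : ℝ × ℝ), g w = f (τ w) := by
    filter_upwards [hτlim.eventually hfg, hV] with w h1 h2
    rw [h1, hστ w h2]
  obtain ⟨hlam0, L, hL, δ, hδ, hlam⟩ := hγ.exists_lipschitz
  obtain ⟨hlam'0, L', hL', δ', hδ', hlam'⟩ := hγ'.exists_lipschitz
  have hbd := eventually_abs_le_of_lipschitz hδ hlam0 hlam
  have hbd' := eventually_abs_le_of_lipschitz hδ' hlam'0 hlam'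
  suffices h : e = e' ∧ P.natDegree = Q.natDegree by
    rw [degree_eq_natDegree hP, degree_eq_natDegree hQ, h.2]
    exact ⟨h.1, rfl⟩
  rcases hξ.eq_or_lt with rfl | hξ
  · obtain ⟨m, ⟨C, hC, hfu⟩, c, hc, η, hη, hfl⟩ := hfm.exists_bounds hfa
    obtain ⟨m', ⟨C', hC', hgu⟩, c', hc', η', hη', hgl⟩ := hgm.exists_bounds hga
    obtain ⟨rfl, hPm⟩ := hPexp.rate_one hP hbd hC hfu hc hη hfl
    obtain ⟨rfl, hQm⟩ := hQexp.rate_one hQ hbd' hC' hgu hc' hη' hgl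
    have hmm : m' ≤ m := by
      obtain ⟨B, hB⟩ := exists_upper_bound_rate_one (by positivity) hbd
        (eventually_comp_le_norm_pow hC' hU hσK hσ0 hfg hgu)
      exact_mod_cast (hPexp.of_upper_bound hP hB).1
    have hmm' : m ≤ m' := by
      obtain ⟨B, hB⟩ := exists_upper_bound_rate_one (by positivity) hbd'
        (eventually_comp_le_norm_pow hC hV hτK hτ0 hgf hfu)
      exact_mod_cast (hQexp.of_upper_bound hQ hB).1
    have : m = m' := le_antisymm hmm' hmm
    exact ⟨by rw [this], by rw [hPm, hQm, this]⟩
  · obtain ⟨W, hWo, h0W, hW⟩ := himage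
    have hcen : Tendsto (fun y => (lam y, y)) (𝓝[>] (0 : ℝ)) (𝓝 (0 : ℝ × ℝ)) := by
      simpa using tendsto_horn one_pos hbd 0
    have hbr : ∀ᶠ y in 𝓝[>] (0 : ℝ), ∃ y' ≥ 0, σ (lam y, y) = (lam' y', y') := by
      filter_upwards [hcen.eventually (hWo.mem_nhds h0W), self_mem_nhdsWithin] with y h1 h2
      have h3 : σ (lam y, y) ∈ branchSet lam' :=
        (hW.subset (Set.mem_image_of_mem σ ⟨⟨(Set.mem_Ioi.1 h2).le, rfl⟩, h1⟩)).1
      exact ⟨_, h3.1, Prod.ext h3.2 rfl⟩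
    have hbr' := eventually_inverse_mem_branch hU hσL.continuousOn hσ0 hτσ hδ hlam0 hlam hlam'0
      hcen hbr
    obtain ⟨B, hB⟩ := exists_upper_bound_of_lipschitz hξ hK (Filter.inter_mem hU hσinv)
      (fun v hv w hw => hσK v hv.1 w hw.1) hσ0 (fun v hv => hv.2) hfg hL hbd hL' hδ' hlam'0 hlam'
      hbr hQexp
    obtain ⟨B', hB'⟩ := exists_upper_bound_of_lipschitz hξ hK (Filter.inter_mem hV hτinv)
      (fun v hv w hw => hτK v hv.1 w hw.1) hτ0 (fun v hv => hv.2) hgf hL' hbd' hL hδ hlam0 hlam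
      hbr' hPexp
    obtain ⟨h1, h2⟩ := hPexp.of_upper_bound hP hB
    obtain ⟨h3, h4⟩ := hQexp.of_upper_bound hQ hB'
    have he : e = e' := le_antisymm h3 h1
    exact ⟨he, le_antisymm (h2 he) (h4 he.symm)⟩
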